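/- arXiv:0905.2550 — 3 statements merged into one kernel-verified Lean document; each statement's English description precedes it below -/
import Mathlib

section
/- Let G be a finite group and N a torsion-free abelian group, regarded as a G-module with trivial action. For every group homomorphism φ : G → N/2N choose a set-theoretic lift φ̃ : G → N (so that φ̃(s) ≡ φ(s) mod 2N); then for all s,t ∈ G the element φ̃(s) + φ̃(t) − φ̃(st) lies in 2N, and the function c_φ(s,t) := (φ̃(s) + φ̃(t) − φ̃(st))/2 is a 2-cocycle of G with values in N whose cohomology class is 2-torsion and does not depend on the chosen lift. Moreover, the resulting map φ ↦ [c_φ] is a group isomorphism from Hom(G, N/2N) onto the 2-torsion subgroup H²(G,N)[2] of H²(G,N). -/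
/-- The 2-cocycle condition for a finite group `G` acting trivially on an abelian
group `N` (written additively). -/
def IsCocycle2 (G N : Type*) [Group G] [AddCommGroup N] (c : G → G → N) : Prop :=
  ∀ s t u : G, c s t + c (s * t) u = c t u + c s (t * u)

/-- The 2-coboundary condition. -/
def IsCoboundary2 (G N : Type*) [Group G] [AddCommGroup N] (c : G → G → N) : Prop :=
  ∃ β : G → N, ∀ s t : G, c s t = β s + β t - β (s * t)

/-- The additive group of 2-cocycles of `G` with values in the trivial module `N`. -/
def cocycles2 (G N : Type*) [Group G] [AddCommGroup N] : AddSubgroup (G → G → N) where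
  carrier := {c | IsCocycle2 G N c}
  zero_mem' := by intro s t u; simp
  add_mem' := by
    intro a b ha hb s t u
    simp only [Pi.add_apply]
    rw [add_add_add_comm, ha s t u, hb s t u, add_add_add_comm]
  neg_mem' := by
    intro a ha s t u
    simp only [Pi.neg_apply, ← neg_add]
    rw [ha s t u]

/-- The additive group of 2-coboundaries of `G` with values in the trivial module `N`. -/
def coboundaries2 (G N : Type*) [Group G] [AddCommGroup N] : AddSubgroup (G → G → N) where
  carrier := {c | IsCoboundary2 G N c}
  zero_mem' := ⟨0, by intro s t; simp⟩
  add_mem' := by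
    rintro a b ⟨α, hα⟩ ⟨γ, hγ⟩
    exact ⟨α + γ, by intro s t; simp only [Pi.add_apply, hα s t, hγ s t]; abel⟩
  neg_mem' := by
    rintro a ⟨α, hα⟩
    exact ⟨-α, by intro s t; simp only [Pi.neg_apply, hα s t]; abel⟩

/-- The second cohomology group `H²(G,N)` of `G` with coefficients in the trivial
module `N`: 2-cocycles modulo 2-coboundaries. -/
def H2 (G N : Type*) [Group G] [AddCommGroup N] : Type _ :=
  cocycles2 G N ⧸ ((coboundaries2 G N).addSubgroupOf (cocycles2 G N))

noncomputable instance (G N : Type*) [Group G] [AddCommGroup N] : AddCommGroup (H2 G N) :=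
  QuotientAddGroup.Quotient.addCommGroup _

/-- The 2-torsion subgroup `H²(G,N)[2]`. -/
def H2torsion2 (G N : Type*) [Group G] [AddCommGroup N] : AddSubgroup (H2 G N) where
  carrier := {x | x + x = 0}
  zero_mem' := by simp
  add_mem' := by
    intro a b ha hb
    show a + b + (a + b) = 0
    rw [add_add_add_comm, ha, hb, add_zero]
  neg_mem' := by
    intro a ha
    show -a + -a = 0
    rw [← neg_add, ha, neg_zero]

/-- The subgroup `2N = {2n : n ∈ N}` of `N`. -/
def twoSub (N : Type*) [AddCommGroup N] : AddSubgroup N where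
  carrier := {n | ∃ m : N, n = m + m}
  zero_mem' := ⟨0, by simp⟩
  add_mem' := by rintro a b ⟨x, rfl⟩ ⟨y, rfl⟩; exact ⟨x + y, by abel⟩
  neg_mem' := by rintro a ⟨x, rfl⟩; exact ⟨-x, by abel⟩

/-- The group `Hom(G, N/2N)` of homomorphisms from `G` to `N/2N`, as an additive group
of functions `G → N/2N`. -/
def homToQuot (G N : Type*) [Group G] [AddCommGroup N] :
    AddSubgroup (G → N ⧸ twoSub N) where
  carrier := {φ | ∀ s t : G, φ (s * t) = φ s + φ t}
  zero_mem' := by intro s t; simp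
  add_mem' := by
    intro a b ha hb s t
    simp only [Pi.add_apply, ha s t, hb s t]
    abel
  neg_mem' := by
    intro a ha s t
    simp only [Pi.neg_apply, ha s t]
    abel

section Halving

variable {G N : Type*} [Group G] [AddCommGroup N]

/-- `h` is a halving of the coboundary of `L`. -/
def IsHalving (L : G → N) (h : G → G → N) : Prop :=
  ∀ s t : G, h s t + h s t = L s + L t - L (s * t)

theorem mk_eq_mk_twoSub_iff {a b : N} :
    (QuotientAddGroup.mk a : N ⧸ twoSub N) = QuotientAddGroup.mk b ↔
      ∃ m : N, a = b + (m + m) := by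
  rw [eq_comm, QuotientAddGroup.eq]
  refine exists_congr fun m => ?_
  rw [neg_add_eq_iff_eq_add]

theorem eq_of_add_self_eq_add_self (hN : ∀ (n : N) (k : ℕ), k ≠ 0 → k • n = 0 → n = 0)
    {a b : N} (hab : a + a = b + b) : a = b := by
  refine sub_eq_zero.mp (hN (a - b) 2 two_ne_zero ?_)
  rw [two_nsmul, sub_add_sub_comm, hab, sub_self]

/-- A homomorphism from a finite group to a torsion-free group is trivial. -/
theorem eq_zero_of_map_mul_eq_add [Finite G]
    (hN : ∀ (n : N) (k : ℕ), k ≠ 0 → k • n = 0 → n = 0)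
    {f : G → N} (hf : ∀ s t : G, f (s * t) = f s + f t) (s : G) : f s = 0 := by
  have hone : f 1 = 0 := by simpa using hf 1 1
  have hpow (n : ℕ) : f (s ^ n) = n • f s := by
    induction n with
    | zero => simpa using hone
    | succ n ih => rw [pow_succ, hf, ih, succ_nsmul]
  refine hN (f s) (orderOf s) (orderOf_pos s).ne' ?_
  rw [← hpow, pow_orderOf_eq_one, hone]

theorem lift_add_sub_mem_twoSub {φ : G → N ⧸ twoSub N}
    (hφ : ∀ s t : G, φ (s * t) = φ s + φ t)
    {L : G → N} (hL : ∀ s : G, QuotientAddGroup.mk (L s) = φ s) (s t : G) :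
    L s + L t - L (s * t) ∈ twoSub N := by
  rw [← QuotientAddGroup.eq_zero_iff, QuotientAddGroup.mk_sub, QuotientAddGroup.mk_add,
    hL, hL, hL, hφ, sub_self]

theorem IsHalving.isCocycle2 (hN : ∀ (n : N) (k : ℕ), k ≠ 0 → k • n = 0 → n = 0)
    {L : G → N} {h : G → G → N} (hh : IsHalving L h) : IsCocycle2 G N h := by
  intro s t u
  apply eq_of_add_self_eq_add_self hN
  rw [add_add_add_comm, hh, hh, add_add_add_comm (h t u), hh, hh, mul_assoc]
  abel

theorem IsHalving.isCoboundary2_sub (hN : ∀ (n : N) (k : ℕ), k ≠ 0 → k • n = 0 → n = 0)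
    {L L' : G → N}
    (hLL' : ∀ s : G, (QuotientAddGroup.mk (L s) : N ⧸ twoSub N) = QuotientAddGroup.mk (L' s))
    {h h' : G → G → N} (hh : IsHalving L h) (hh' : IsHalving L' h') :
    IsCoboundary2 G N (h - h') := by
  choose β hβ using fun s => mk_eq_mk_twoSub_iff.mp (hLL' s)
  refine ⟨β, fun s t => eq_of_add_self_eq_add_self hN ?_⟩
  simp only [Pi.sub_apply]
  rw [sub_add_sub_comm, hh, hh', hβ s, hβ t, hβ (s * t)]
  abel

theorem IsHalving.add {L L' : G → N} {h h' : G → G → N} (hh : IsHalving L h)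
    (hh' : IsHalving L' h') : IsHalving (L + L') (h + h') := by
  intro s t
  simp only [Pi.add_apply]
  rw [add_add_add_comm, hh, hh']
  abel

theorem exists_lift_isHalving (φ : homToQuot G N) :
    ∃ (L : G → N) (h : G → G → N),
      (∀ s : G, QuotientAddGroup.mk (L s) = (φ : G → N ⧸ twoSub N) s) ∧ IsHalving L h := by
  choose L hL using fun s => QuotientAddGroup.mk_surjective ((φ : G → N ⧸ twoSub N) s)
  choose h hh using lift_add_sub_mem_twoSub φ.2 hL
  exact ⟨L, h, hL, fun s t => (hh s t).symm⟩

theorem H2_mk_eq_mk_iff {a b : cocycles2 G N} :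
    (QuotientAddGroup.mk a : H2 G N) = QuotientAddGroup.mk b ↔
      IsCoboundary2 G N ((a : G → G → N) - b) := by
  rw [eq_comm]
  refine QuotientAddGroup.eq.trans ?_
  rw [neg_add_eq_sub]
  rfl

theorem H2_mk_mem_H2torsion2_iff {c : cocycles2 G N} :
    (QuotientAddGroup.mk c : H2 G N) ∈ H2torsion2 G N ↔
      IsCoboundary2 G N ((c : G → G → N) + c) := by
  refine Iff.trans ?_ ((H2_mk_eq_mk_iff (a := c + c) (b := 0)).trans ?_)
  · rfl
  · simp

theorem IsHalving.mk_mem_H2torsion2 {L : G → N} {h : G → G → N} (hh : IsHalving L h)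
    (hcoc : h ∈ cocycles2 G N) : (QuotientAddGroup.mk ⟨h, hcoc⟩ : H2 G N) ∈ H2torsion2 G N :=
  H2_mk_mem_H2torsion2_iff.mpr ⟨L, hh⟩

/-- The map `φ ↦ [c_φ]` from `Hom(G, N/2N)` to `H²(G,N)[2]`. -/
noncomputable def homToH2torsion2 (hN : ∀ (n : N) (k : ℕ), k ≠ 0 → k • n = 0 → n = 0)
    (φ : homToQuot G N) : H2torsion2 G N :=
  have hh := (exists_lift_isHalving φ).choose_spec.choose_spec.2
  ⟨_, hh.mk_mem_H2torsion2 (hh.isCocycle2 hN)⟩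

theorem homToH2torsion2_eq_mk (hN : ∀ (n : N) (k : ℕ), k ≠ 0 → k • n = 0 → n = 0)
    (φ : homToQuot G N) {L : G → N}
    (hL : ∀ s : G, QuotientAddGroup.mk (L s) = (φ : G → N ⧸ twoSub N) s)
    {h : G → G → N} (hh : IsHalving L h) (hcoc : h ∈ cocycles2 G N) :
    (homToH2torsion2 hN φ : H2 G N) = QuotientAddGroup.mk ⟨h, hcoc⟩ := by
  obtain ⟨hL', hh'⟩ := (exists_lift_isHalving φ).choose_spec.choose_spec
  exact H2_mk_eq_mk_iff.mpr
    (IsHalving.isCoboundary2_sub hN (fun s => (hL' s).trans (hL s).symm) hh' hh)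

theorem homToH2torsion2_add (hN : ∀ (n : N) (k : ℕ), k ≠ 0 → k • n = 0 → n = 0)
    (φ ψ : homToQuot G N) :
    homToH2torsion2 hN (φ + ψ) = homToH2torsion2 hN φ + homToH2torsion2 hN ψ := by
  obtain ⟨L, h, hL, hh⟩ := exists_lift_isHalving φ
  obtain ⟨L', h', hL', hh'⟩ := exists_lift_isHalving ψ
  have hsum : ∀ s : G, QuotientAddGroup.mk ((L + L') s) =
      ((φ + ψ : homToQuot G N) : G → N ⧸ twoSub N) s := fun s => by
    simp [hL, hL']
  apply Subtype.ext
  rw [AddSubgroup.coe_add, homToH2torsion2_eq_mk hN φ hL hh (hh.isCocycle2 hN),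
    homToH2torsion2_eq_mk hN ψ hL' hh' (hh'.isCocycle2 hN),
    homToH2torsion2_eq_mk hN _ hsum (hh.add hh') ((hh.add hh').isCocycle2 hN)]
  rfl

theorem eq_zero_of_homToH2torsion2_eq_zero [Finite G]
    (hN : ∀ (n : N) (k : ℕ), k ≠ 0 → k • n = 0 → n = 0)
    {φ : homToQuot G N} (hφ : homToH2torsion2 hN φ = 0) : φ = 0 := by
  obtain ⟨L, h, hL, hh⟩ := exists_lift_isHalving φ
  have hzero := (homToH2torsion2_eq_mk hN φ hL hh (hh.isCocycle2 hN)).symm.trans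
    (congrArg Subtype.val hφ)
  obtain ⟨β, hβ⟩ := (H2_mk_eq_mk_iff (b := 0)).mp hzero
  have hβ' (s t : G) : h s t = β s + β t - β (s * t) := by simpa using hβ s t
  have hmul (s t : G) : L (s * t) - (β (s * t) + β (s * t)) =
      L s - (β s + β s) + (L t - (β t + β t)) := by
    have hst := hh s t
    rw [hβ', eq_sub_iff_add_eq] at hst
    rw [sub_add_sub_comm, ← hst]
    abel
  apply Subtype.ext
  funext s
  rw [← hL s]
  exact (QuotientAddGroup.eq_zero_iff _).mpr
    ⟨β s, sub_eq_zero.mp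
      (eq_zero_of_map_mul_eq_add (f := fun s => L s - (β s + β s)) hN hmul s)⟩

theorem homToH2torsion2_surjective (hN : ∀ (n : N) (k : ℕ), k ≠ 0 → k • n = 0 → n = 0) :
    Function.Surjective (homToH2torsion2 (G := G) hN) := by
  rintro ⟨x, hx⟩
  obtain ⟨c, rfl⟩ := QuotientAddGroup.mk_surjective x
  obtain ⟨β, hβ⟩ := H2_mk_mem_H2torsion2_iff.mp hx
  have hhom : (fun s => (QuotientAddGroup.mk (β s) : N ⧸ twoSub N)) ∈ homToQuot G N := by
    intro s t
    rw [← QuotientAddGroup.mk_add, eq_comm]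
    refine mk_eq_mk_twoSub_iff.mpr ⟨(c : G → G → N) s t, ?_⟩
    rw [← sub_eq_iff_eq_add']
    exact (hβ s t).symm
  exact ⟨⟨_, hhom⟩, Subtype.ext
    (homToH2torsion2_eq_mk hN ⟨_, hhom⟩ (fun _ => rfl) hβ c.2)⟩

/-- `homToH2torsion2` as a homomorphism of additive groups. -/
noncomputable def homToH2torsion2Hom (hN : ∀ (n : N) (k : ℕ), k ≠ 0 → k • n = 0 → n = 0) :
    homToQuot G N →+ H2torsion2 G N :=
  AddMonoidHom.mk' (homToH2torsion2 hN) (homToH2torsion2_add hN)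

/-- The isomorphism `Hom(G, N/2N) ≃ H²(G,N)[2]`, for `G` finite and `N` torsion-free. -/
noncomputable def homToQuotEquivH2torsion2 [Finite G]
    (hN : ∀ (n : N) (k : ℕ), k ≠ 0 → k • n = 0 → n = 0) : homToQuot G N ≃+ H2torsion2 G N :=
  AddEquiv.ofBijective (homToH2torsion2Hom hN)
    ⟨(injective_iff_map_eq_zero (homToH2torsion2Hom hN)).mpr fun _ hφ =>
      eq_zero_of_homToH2torsion2_eq_zero hN hφ, homToH2torsion2_surjective hN⟩

end Halving

/-- Let `G` be a finite group and `N` a torsion-free abelian group with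
trivial `G`-action.  For any homomorphism `φ : G → N/2N` and any set-theoretic lift
`L : G → N` of `φ`, the elements `L(s) + L(t) - L(st)` lie in `2N`; any "halving"
`h` of `(s,t) ↦ L(s) + L(t) - L(st)` is a 2-cocycle whose double is a coboundary (so its
class is 2-torsion), and its class does not depend on the chosen lift.  Moreover
`φ ↦ [c_φ]` is a group isomorphism `Hom(G, N/2N) ≃ H²(G,N)[2]`. -/
theorem hom_equiv_H2_two_torsion (G N : Type*) [Group G] [Fintype G] [AddCommGroup N]
    (hN : ∀ (n : N) (k : ℕ), k ≠ 0 → k • n = 0 → n = 0) :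
    -- (1) lift differences lie in 2N
    (∀ φ : G → N ⧸ twoSub N, (∀ s t : G, φ (s * t) = φ s + φ t) →
      ∀ L : G → N, (∀ s : G, QuotientAddGroup.mk (L s) = φ s) →
        ∀ s t : G, L s + L t - L (s * t) ∈ twoSub N) ∧
    -- (2),(3) any halving is a 2-cocycle whose double is a coboundary
    (∀ φ : G → N ⧸ twoSub N, (∀ s t : G, φ (s * t) = φ s + φ t) →
      ∀ L : G → N, (∀ s : G, QuotientAddGroup.mk (L s) = φ s) →
        ∀ h : G → G → N, (∀ s t : G, h s t + h s t = L s + L t - L (s * t)) →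
          IsCocycle2 G N h ∧ IsCoboundary2 G N (h + h)) ∧
    -- (4) independence of the chosen lift: the two cocycles are cohomologous
    (∀ φ : G → N ⧸ twoSub N, (∀ s t : G, φ (s * t) = φ s + φ t) →
      ∀ L L' : G → N, (∀ s : G, QuotientAddGroup.mk (L s) = φ s) →
        (∀ s : G, QuotientAddGroup.mk (L' s) = φ s) →
        ∀ h h' : G → G → N,
          (∀ s t : G, h s t + h s t = L s + L t - L (s * t)) →
          (∀ s t : G, h' s t + h' s t = L' s + L' t - L' (s * t)) →
          IsCoboundary2 G N (h - h')) ∧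
    -- (5) the map φ ↦ [c_φ] is a group isomorphism onto H²(G,N)[2]
    ∃ e : homToQuot G N ≃+ H2torsion2 G N,
      ∀ (φ : homToQuot G N) (L : G → N),
        (∀ s : G, QuotientAddGroup.mk (L s) = (φ : G → N ⧸ twoSub N) s) →
        ∀ (h : G → G → N), (∀ s t : G, h s t + h s t = L s + L t - L (s * t)) →
        ∀ (hcoc : h ∈ cocycles2 G N),
          ((e φ : H2torsion2 G N) : H2 G N) = QuotientAddGroup.mk ⟨h, hcoc⟩ := by
  refine ⟨fun φ hφ L hL => lift_add_sub_mem_twoSub hφ hL, fun φ hφ L hL h hh => ?_,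
    fun φ hφ L L' hL hL' h h' hh hh' => ?_, homToQuotEquivH2torsion2 hN,
    fun φ L hL h hh hcoc => homToH2torsion2_eq_mk hN φ hL hh hcoc⟩
  · exact ⟨IsHalving.isCocycle2 hN hh, L, hh⟩
  · exact IsHalving.isCoboundary2_sub hN (fun s => (hL s).trans (hL' s).symm) hh hh'
end

section
/- Let G be a finite group and N a torsion-free abelian group, and let M = {±1} × N be regarded as a G-module with trivial action. Then there is a group isomorphism H²(G,M)[2] ≅ H²(G,{±1}) × Hom(G, N/2N), where the first factor is induced by the projection M → {±1} and the second factor sends the class of a 2-cocycle c to the homomorphism G → N/2N induced by the N-component of c via the 2-torsion condition. -/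
/-- The (multiplicative) 2-cocycle condition for a group `G` acting trivially on an
abelian group `M`. -/
def IsMulCocycle2 (G M : Type*) [Group G] [CommGroup M] (c : G → G → M) : Prop :=
  ∀ s t u : G, c s t * c (s * t) u = c t u * c s (t * u)

/-- The (multiplicative) 2-coboundary condition. -/
def IsMulCoboundary2 (G M : Type*) [Group G] [CommGroup M] (c : G → G → M) : Prop :=
  ∃ β : G → M, ∀ s t : G, c s t = β s * β t * (β (s * t))⁻¹

/-- The group of 2-cocycles of `G` with values in the trivial module `M`. -/
def mulCocycles2 (G M : Type*) [Group G] [CommGroup M] : Subgroup (G → G → M) where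
  carrier := {c | IsMulCocycle2 G M c}
  one_mem' := by intro s t u; simp
  mul_mem' := by
    intro a b ha hb s t u
    simp only [Pi.mul_apply]
    rw [mul_mul_mul_comm, ha s t u, hb s t u, mul_mul_mul_comm]
  inv_mem' := by
    intro a ha s t u
    simp only [Pi.inv_apply, ← mul_inv]
    rw [ha s t u]

/-- The group of 2-coboundaries of `G` with values in the trivial module `M`. -/
def mulCoboundaries2 (G M : Type*) [Group G] [CommGroup M] : Subgroup (G → G → M) where
  carrier := {c | IsMulCoboundary2 G M c}
  one_mem' := ⟨1, by intro s t; simp⟩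
  mul_mem' := by
    rintro a b ⟨α, hα⟩ ⟨γ, hγ⟩
    refine ⟨α * γ, fun s t => ?_⟩
    simp only [Pi.mul_apply, hα s t, hγ s t, mul_inv]
    simp only [mul_assoc, mul_comm, mul_left_comm]
  inv_mem' := by
    rintro a ⟨α, hα⟩
    refine ⟨α⁻¹, fun s t => ?_⟩
    simp only [Pi.inv_apply, hα s t, mul_inv, inv_inv]

/-- The second cohomology group `H²(G,M)` with coefficients in the trivial module `M`. -/
def H2m (G M : Type*) [Group G] [CommGroup M] : Type _ :=
  mulCocycles2 G M ⧸ ((mulCoboundaries2 G M).subgroupOf (mulCocycles2 G M))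

noncomputable instance (G M : Type*) [Group G] [CommGroup M] : CommGroup (H2m G M) :=
  QuotientGroup.Quotient.commGroup _

/-- The 2-torsion subgroup `H²(G,M)[2]`. -/
def H2mTorsion2 (G M : Type*) [Group G] [CommGroup M] : Subgroup (H2m G M) where
  carrier := {x | x * x = 1}
  one_mem' := by simp
  mul_mem' := by
    intro a b ha hb
    show a * b * (a * b) = 1
    rw [mul_mul_mul_comm, ha, hb, mul_one]
  inv_mem' := by
    intro a ha
    show a⁻¹ * a⁻¹ = 1
    rw [← mul_inv, ha, inv_one]

/-- The subgroup `N² = {n² : n ∈ N}` of squares of `N` (written multiplicatively, this is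
"`2N`" for the abelian group `N`). -/
def sqSub (N : Type*) [CommGroup N] : Subgroup N where
  carrier := {n | ∃ m : N, n = m * m}
  one_mem' := ⟨1, by simp⟩
  mul_mem' := by
    rintro a b ⟨x, rfl⟩ ⟨y, rfl⟩
    exact ⟨x * y, by simp only [mul_assoc, mul_comm, mul_left_comm]⟩
  inv_mem' := by rintro a ⟨x, rfl⟩; exact ⟨x⁻¹, by rw [mul_inv]⟩

/-- The group `Hom(G, N/2N)` of homomorphisms `G → N/N²`, as a group of functions. -/
def homToQuotM (G N : Type*) [Group G] [CommGroup N] :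
    Subgroup (G → N ⧸ sqSub N) where
  carrier := {φ | ∀ s t : G, φ (s * t) = φ s * φ t}
  one_mem' := by intro s t; simp
  mul_mem' := by
    intro a b ha hb s t
    simp only [Pi.mul_apply, ha s t, hb s t]
    simp only [mul_assoc, mul_comm, mul_left_comm]
  inv_mem' := by
    intro a ha s t
    simp only [Pi.inv_apply, ha s t, mul_inv]

/-- Homomorphisms from a finite group to a torsion-free group are trivial. -/
theorem eq_one_of_map_mul_of_torsionFree {G N : Type*} [Group G] [Finite G] [CommGroup N]
    (hN : ∀ (n : N) (k : ℕ), k ≠ 0 → n ^ k = 1 → n = 1) (f : G → N)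
    (hf : ∀ s t, f (s * t) = f s * f t) (s : G) : f s = 1 := by
  refine hN _ (Nat.card G) Nat.card_pos.ne' ?_
  have h := map_pow (MonoidHom.mk' f hf) s (Nat.card G)
  rwa [pow_card_eq_one', map_one, eq_comm] at h

/-- Over a torsion-free group, squaring is injective. -/
theorem eq_of_mul_self_eq_of_torsionFree {N : Type*} [CommGroup N]
    (hN : ∀ (n : N) (k : ℕ), k ≠ 0 → n ^ k = 1 → n = 1) {a b : N} (h : a * a = b * b) :
    a = b := by
  refine div_eq_one.mp (hN (a / b) 2 two_ne_zero ?_)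
  rw [div_pow, sq, sq, h, div_self']

/-- A cochain with values in a torsion-free group is determined by its coboundary. -/
theorem eq_of_coboundary_eq_of_torsionFree {G N : Type*} [Group G] [Finite G] [CommGroup N]
    (hN : ∀ (n : N) (k : ℕ), k ≠ 0 → n ^ k = 1 → n = 1) {β γ : G → N}
    (h : ∀ s t, β s * β t * (β (s * t))⁻¹ = γ s * γ t * (γ (s * t))⁻¹) : β = γ := by
  funext s
  refine div_eq_one.mp (eq_one_of_map_mul_of_torsionFree hN (fun s => β s / γ s) ?_ s)
  intro s t
  have h' := h s t
  rw [mul_inv_eq_iff_eq_mul] at h'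
  rw [div_mul_div_comm, h', div_eq_div_iff_mul_eq_mul]
  rw [mul_right_comm, inv_mul_cancel_right, mul_comm]

/-- Coboundaries are cocycles. -/
theorem isMulCocycle2_coboundary {G M : Type*} [Group G] [CommGroup M] (β : G → M) :
    IsMulCocycle2 G M fun s t => β s * β t * (β (s * t))⁻¹ := by
  intro s t u
  simp only [mul_assoc s t u]
  apply Additive.ofMul.injective
  simp only [ofMul_mul, ofMul_inv]
  abel

/-- A cocycle is trivial in `H²` if and only if it is a coboundary. -/
theorem H2m_mk_eq_one_iff {G M : Type*} [Group G] [CommGroup M] (c : mulCocycles2 G M) :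
    (QuotientGroup.mk c : H2m G M) = 1 ↔ IsMulCoboundary2 G M c.1 :=
  (QuotientGroup.eq_one_iff c).trans Iff.rfl

/-- Pairs of a cocycle `c` with values in `{±1} × N` and a cochain `β` whose coboundary is the
square of the `N`-component of `c`. -/
def squareTrivializedCocycles (G N : Type*) [Group G] [CommGroup N] :
    Subgroup (mulCocycles2 G (ℤˣ × N) × (G → N)) where
  carrier := {p | ∀ s t, (p.1.1 s t).2 * (p.1.1 s t).2 = p.2 s * p.2 t * (p.2 (s * t))⁻¹}
  one_mem' := by intro s t; simp
  mul_mem' := by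
    intro p q hp hq s t
    have h := congrArg₂ (· * ·) (hp s t) (hq s t)
    simp only [Prod.fst_mul, Prod.snd_mul, Subgroup.coe_mul, Pi.mul_apply, mul_inv] at h ⊢
    rw [mul_mul_mul_comm, h, mul_mul_mul_comm, mul_mul_mul_comm (p.2 s)]
  inv_mem' := by
    intro p hp s t
    have h := congrArg (·⁻¹) (hp s t)
    simpa only [Prod.fst_inv, Prod.snd_inv, Subgroup.coe_inv, Pi.inv_apply, mul_inv] using h

/-- The class of a square-trivialized cocycle is 2-torsion. -/
noncomputable def squareTrivializedCocycles.toTorsion (G N : Type*) [Group G] [CommGroup N] :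
    squareTrivializedCocycles G N →* H2mTorsion2 G (ℤˣ × N) :=
  MonoidHom.codRestrict
    (((QuotientGroup.mk' ((mulCoboundaries2 G (ℤˣ × N)).subgroupOf _)).comp
      ((MonoidHom.fst _ _).comp (squareTrivializedCocycles G N).subtype) :
        squareTrivializedCocycles G N →* H2m G (ℤˣ × N)))
    (H2mTorsion2 G (ℤˣ × N)) (fun p =>
      (H2m_mk_eq_one_iff (p.1.1 * p.1.1)).mpr ⟨fun s => (1, p.1.2 s), fun s t =>
        Prod.ext (by simp [Int.units_mul_self]) (by simpa using p.2 s t)⟩)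

/-- Projection of cocycles to the `{±1}`-component. -/
def mulCocycles2Fst (G A B : Type*) [Group G] [CommGroup A] [CommGroup B] :
    mulCocycles2 G (A × B) →* mulCocycles2 G A where
  toFun c := ⟨fun s t => (c.1 s t).1, fun s t u => congrArg Prod.fst (c.2 s t u)⟩
  map_one' := rfl
  map_mul' _ _ := rfl

/-- The homomorphism `G → N/2N` attached to a square-trivialized cocycle. -/
def squareTrivializedCocycles.toHomQuot (G N : Type*) [Group G] [CommGroup N] :
    squareTrivializedCocycles G N →* homToQuotM G N where
  toFun p := ⟨fun s => QuotientGroup.mk (p.1.2 s), fun s t => by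
    rw [← QuotientGroup.mk_mul, eq_comm, QuotientGroup.eq_iff_div_mem]
    exact ⟨_, by rw [p.2 s t, div_eq_mul_inv]⟩⟩
  map_one' := rfl
  map_mul' _ _ := rfl

/-- The pair of invariants of a square-trivialized cocycle in `H²(G,{±1}) × Hom(G, N/2N)`. -/
noncomputable def squareTrivializedCocycles.toProd (G N : Type*) [Group G] [CommGroup N] :
    squareTrivializedCocycles G N →* H2m G ℤˣ × homToQuotM G N :=
  MonoidHom.prod
    ((QuotientGroup.mk' ((mulCoboundaries2 G ℤˣ).subgroupOf _)).comp ((mulCocycles2Fst G ℤˣ N).comp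
      ((MonoidHom.fst _ _).comp (squareTrivializedCocycles G N).subtype)))
    (toHomQuot G N)

theorem squareTrivializedCocycles.toTorsion_surjective (G N : Type*) [Group G] [CommGroup N] :
    Function.Surjective (toTorsion G N) := by
  rintro ⟨x, hx⟩
  obtain ⟨c, rfl⟩ := QuotientGroup.mk_surjective x
  obtain ⟨β, hβ⟩ := (H2m_mk_eq_one_iff (c * c)).mp hx
  exact ⟨⟨(c, fun s => (β s).2), fun s t => congrArg Prod.snd (hβ s t)⟩, rfl⟩

theorem squareTrivializedCocycles.toProd_surjective {G N : Type*} [Group G] [CommGroup N]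
    (hN : ∀ (n : N) (k : ℕ), k ≠ 0 → n ^ k = 1 → n = 1) :
    Function.Surjective (toProd G N) := by
  rintro ⟨x, φ, hφ⟩
  obtain ⟨a, rfl⟩ := QuotientGroup.mk_surjective x
  choose β hβ using fun s => QuotientGroup.mk_surjective (φ s)
  have h (s t : G) : ∃ n : N, β s * β t * (β (s * t))⁻¹ = n * n := by
    have h' := hφ s t
    rw [← hβ, ← hβ, ← hβ, ← QuotientGroup.mk_mul, eq_comm, QuotientGroup.eq_iff_div_mem,
      div_eq_mul_inv] at h'
    exact h'
  choose n hn using h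
  have hcoc : IsMulCocycle2 G N n := by
    intro s t u
    apply eq_of_mul_self_eq_of_torsionFree hN
    rw [mul_mul_mul_comm, mul_mul_mul_comm (n t u)]
    simp only [← hn]
    exact isMulCocycle2_coboundary β s t u
  refine ⟨⟨(⟨fun s t => (a.1 s t, n s t), fun s t u => Prod.ext (a.2 s t u) (hcoc s t u)⟩, β),
    fun s t => (hn s t).symm⟩, ?_⟩
  exact Prod.ext rfl (Subtype.ext (funext hβ))

theorem squareTrivializedCocycles.ker_toTorsion {G N : Type*} [Group G] [Finite G] [CommGroup N]
    (hN : ∀ (n : N) (k : ℕ), k ≠ 0 → n ^ k = 1 → n = 1) :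
    (toTorsion G N).ker = (toProd G N).ker := by
  ext ⟨⟨c, β⟩, hp⟩
  rw [MonoidHom.mem_ker, MonoidHom.mem_ker, Prod.ext_iff]
  refine (Subtype.ext_iff.trans (H2m_mk_eq_one_iff c)).trans (Iff.trans ?_
    (and_congr (H2m_mk_eq_one_iff (mulCocycles2Fst G ℤˣ N c)).symm
      (Subtype.ext_iff.trans funext_iff).symm))
  constructor
  · rintro ⟨γ, hγ⟩
    refine ⟨⟨fun s => (γ s).1, fun s t => congrArg Prod.fst (hγ s t)⟩, fun s => ?_⟩
    have h : β = fun s => (γ s).2 * (γ s).2 := by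
      refine eq_of_coboundary_eq_of_torsionFree hN fun s t => (hp s t).symm.trans ?_
      simp only [hγ, Prod.snd_mul, Prod.snd_inv, mul_inv]
      rw [mul_mul_mul_comm, mul_mul_mul_comm (γ s).2]
    exact (QuotientGroup.eq_one_iff _).mpr ⟨_, congrFun h s⟩
  · rintro ⟨⟨α, hα⟩, h⟩
    choose γ hγ using fun s => (QuotientGroup.eq_one_iff (β s)).mp (h s)
    refine ⟨fun s => (α s, γ s), fun s t => Prod.ext (hα s t) ?_⟩
    apply eq_of_mul_self_eq_of_torsionFree hN
    refine (hp s t).trans ?_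
    simp only [hγ, Prod.snd_mul, Prod.snd_inv, mul_inv]
    rw [mul_mul_mul_comm (γ s), mul_mul_mul_comm (γ s * γ t)]

/-- Let `G` be a finite group, `N` a torsion-free abelian group, and
`M = {±1} × N` a trivial `G`-module (with `{±1} = ℤˣ`).  Then there is a group
isomorphism `H²(G,M)[2] ≅ H²(G,{±1}) × Hom(G, N/2N)`: the first factor is induced by the
projection `M → {±1}`, and the second sends the class of a 2-cocycle `c` to the
homomorphism `G → N/2N` induced by the `N`-component of `c` via the 2-torsion condition
(i.e. by any `β : G → N` with `c_N² = β(s)β(t)β(st)⁻¹`, it is `s ↦ β(s) mod 2N`). -/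
theorem H2_two_torsion_decomposition (G N : Type*) [Group G] [Fintype G] [CommGroup N]
    (hN : ∀ (n : N) (k : ℕ), k ≠ 0 → n ^ k = 1 → n = 1) :
    ∃ e : H2mTorsion2 G (ℤˣ × N) ≃* (H2m G ℤˣ × homToQuotM G N),
      ∀ (c : G → G → ℤˣ × N) (hcoc : c ∈ mulCocycles2 G (ℤˣ × N))
        (hmem : (QuotientGroup.mk ⟨c, hcoc⟩ : H2m G (ℤˣ × N)) ∈ H2mTorsion2 G (ℤˣ × N))
        (hcoc1 : (fun s t => (c s t).1) ∈ mulCocycles2 G ℤˣ),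
        (e ⟨QuotientGroup.mk ⟨c, hcoc⟩, hmem⟩).1 =
            (QuotientGroup.mk ⟨fun s t => (c s t).1, hcoc1⟩ : H2m G ℤˣ) ∧
        ∀ β : G → N, (∀ s t : G, (c s t).2 * (c s t).2 = β s * β t * (β (s * t))⁻¹) →
          ((e ⟨QuotientGroup.mk ⟨c, hcoc⟩, hmem⟩).2 : G → N ⧸ sqSub N) =
            fun s => QuotientGroup.mk (β s) := by
  let f := squareTrivializedCocycles.toTorsion G N
  let g := squareTrivializedCocycles.toProd G N
  have hf : Function.Surjective f := squareTrivializedCocycles.toTorsion_surjective G N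
  have hg : Function.Surjective g := squareTrivializedCocycles.toProd_surjective hN
  let e := (QuotientGroup.quotientKerEquivOfSurjective f hf).symm.trans
    ((QuotientGroup.quotientMulEquivOfEq (squareTrivializedCocycles.ker_toTorsion hN)).trans
      (QuotientGroup.quotientKerEquivOfSurjective g hg))
  have he (p : squareTrivializedCocycles G N) : e (f p) = g p := by
    have h : (QuotientGroup.quotientKerEquivOfSurjective f hf).symm (f p) = QuotientGroup.mk p :=
      (MulEquiv.symm_apply_eq _).mpr rfl
    simp only [e, MulEquiv.trans_apply, h]
    rfl
  refine ⟨e, fun c hcoc hmem hcoc1 => ⟨?_, fun β hβ => ?_⟩⟩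
  · let x : mulCocycles2 G (ℤˣ × N) := ⟨c, hcoc⟩
    obtain ⟨β, hβ⟩ := (H2m_mk_eq_one_iff (x * x)).mp hmem
    exact congrArg Prod.fst
      (he ⟨(x, fun s => (β s).2), fun s t => congrArg Prod.snd (hβ s t)⟩)
  · exact congrArg (fun q => (q.2 : G → N ⧸ sqSub N)) (he ⟨(⟨c, hcoc⟩, β), hβ⟩)
end

section
/- Let p be an odd prime, n ≥ 1 an integer, and χ a Dirichlet character modulo pⁿ with values in ℂ. Then χ(-1) = -1 if and only if the order of χ (as an element of the group of Dirichlet characters modulo pⁿ) is divisible by 2^{v₂(p-1)}, where v₂(p-1) denotes the exponent of 2 in the prime factorization of p-1. -/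
theorem Nat.two_pow_dvd_iff_not_dvd_of_odd {d w m : ℕ} (hm : Odd m) (hd : d ∣ 2 ^ (w + 1) * m) :
    2 ^ (w + 1) ∣ d ↔ ¬ d ∣ 2 ^ w * m := by
  constructor
  · intro h h'
    have h2 : 2 ^ (w + 1) ∣ 2 ^ w * m := h.trans h'
    rw [pow_succ] at h2
    have : 2 ∣ m := Nat.dvd_of_mul_dvd_mul_left (by positivity) h2
    exact Nat.not_even_iff_odd.2 hm (even_iff_two_dvd.2 this)
  · intro h
    obtain ⟨x, y, hx, hy, rfl⟩ := (Nat.dvd_mul).1 hd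
    obtain ⟨a, ha, rfl⟩ := (Nat.dvd_prime_pow Nat.prime_two).1 hx
    rcases ha.lt_or_eq with ha | rfl
    · exact absurd (Nat.mul_dvd_mul (pow_dvd_pow 2 (Nat.lt_succ_iff.1 ha)) hy) h
    · exact dvd_mul_right _ _

theorem MulChar.orderOf_eq_orderOf_apply_of_forall_mem_zpowers {R R' : Type*} [CommMonoid R]
    [CommMonoidWithZero R'] (χ : MulChar R R') {g : Rˣ} (hg : ∀ u, u ∈ Subgroup.zpowers g) :
    orderOf χ = orderOf (χ g) := by
  refine orderOf_eq_orderOf_iff.2 fun k => ?_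
  rw [← MulChar.pow_apply_coe]
  refine ⟨fun h => by rw [h, MulChar.one_apply_coe], fun h => ?_⟩
  have hg1 : equivToUnitHom (χ ^ k) g = 1 := Units.ext (by simpa using h)
  refine MulChar.eq_one_iff.2 fun u => ?_
  obtain ⟨i, rfl⟩ := Subgroup.mem_zpowers_iff.1 (hg u)
  rw [← coe_equivToUnitHom, map_zpow, hg1, one_zpow, Units.val_one]

theorem Units.neg_one_eq_pow_of_orderOf_eq_two_mul {R : Type*} [Ring R] {g : Rˣ} {k : ℕ}
    (hne : (-1 : Rˣ) ≠ 1) (hg : -1 ∈ Subgroup.zpowers g) (hk : orderOf g = 2 * k) :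
    -1 = g ^ k := by
  obtain ⟨j, hj⟩ := Subgroup.mem_zpowers_iff.1 hg
  have h2 : ((2 * k : ℕ) : ℤ) ∣ j * 2 := by
    rw [← hk, orderOf_dvd_iff_zpow_eq_one, zpow_mul, hj]
    exact neg_one_sq
  obtain ⟨c, hc⟩ := h2
  obtain rfl : j = k * c := by push_cast at hc; linarith
  have hgk : (g ^ k) ^ (2 : ℤ) = 1 := by
    rw [zpow_ofNat, ← pow_mul', ← hk, pow_orderOf_eq_one]
  rw [zpow_mul, zpow_natCast] at hj
  rcases Int.even_or_odd' c with ⟨e, rfl | rfl⟩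
  · rw [zpow_mul, hgk, one_zpow] at hj
    exact absurd hj.symm hne
  · rw [zpow_add, zpow_mul, zpow_one] at hj
    rw [← hj, hgk, one_zpow, one_mul]

/-- Let `p` be an odd prime, `n ≥ 1`, and `χ` a Dirichlet character modulo `pⁿ`
with values in `ℂ`. Then `χ(-1) = -1` if and only if the order of `χ` (in the group of
Dirichlet characters modulo `pⁿ`) is divisible by `2^{v₂(p-1)}`. -/
theorem dirichlet_odd_iff_order (p n : ℕ) (hp : p.Prime) (hodd : p ≠ 2) (hn : 1 ≤ n)
    (χ : DirichletCharacter ℂ (p ^ n)) :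
    χ (-1) = -1 ↔ 2 ^ ((p - 1).factorization 2) ∣ orderOf χ := by
  have := ZMod.isCyclic_units_of_prime_pow p hp hodd n
  have : NeZero (p ^ n) := ⟨pow_ne_zero _ hp.ne_zero⟩
  have hp2 : 2 < p := lt_of_le_of_ne hp.two_le hodd.symm
  have : Fact (2 < p ^ n) := ⟨hp2.trans_le (Nat.le_self_pow (by lia) p)⟩
  obtain ⟨g, hg⟩ := IsCyclic.exists_generator (α := (ZMod (p ^ n))ˣ)
  have hcard : orderOf g = p ^ (n - 1) * (p - 1) := by
    rw [orderOf_eq_card_of_forall_mem_zpowers hg, Nat.card_eq_fintype_card,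
      ZMod.card_units_eq_totient, Nat.totient_prime_pow hp hn]
  have hw : (p - 1).factorization 2 ≠ 0 :=
    (Nat.prime_two.factorization_pos_of_dvd (by lia)
      (even_iff_two_dvd.1 (hp.even_sub_one hodd))).ne'
  obtain ⟨w, hw⟩ := Nat.exists_eq_succ_of_ne_zero hw
  set m := p ^ (n - 1) * ((p - 1) / 2 ^ (p - 1).factorization 2) with hm
  have hm_odd : Odd m := (hp.odd_of_ne_two hodd).pow.mul <| Nat.not_even_iff_odd.1 fun h =>
    Nat.not_dvd_ordCompl Nat.prime_two (by lia) (even_iff_two_dvd.1 h)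
  have hg_order : orderOf g = 2 ^ (w + 1) * m := by
    rw [hcard, hm, ← Nat.succ_eq_add_one, ← hw, mul_left_comm, Nat.ordProj_mul_ordCompl_eq_self]
  have hneg : (-1 : (ZMod (p ^ n))ˣ) = g ^ (2 ^ w * m) := by
    refine Units.neg_one_eq_pow_of_orderOf_eq_two_mul ?_ (hg (-1)) (by rw [hg_order]; ring)
    exact fun h => ZMod.neg_one_ne_one (by simpa using congrArg Units.val h)
  have hχneg : χ (-1) = χ g ^ (2 ^ w * m) := by
    rw [← map_pow, ← Units.val_pow_eq_pow_val, ← hneg, Units.val_neg, Units.val_one]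
  have hdvd : orderOf χ ∣ 2 ^ (w + 1) * m := by
    rw [χ.orderOf_eq_orderOf_apply_of_forall_mem_zpowers hg, orderOf_dvd_iff_pow_eq_one,
      pow_succ', mul_assoc, pow_mul', ← hχneg, ← map_pow, neg_one_sq, map_one]
  rw [hw, Nat.succ_eq_add_one, Nat.two_pow_dvd_iff_not_dvd_of_odd hm_odd hdvd,
    χ.orderOf_eq_orderOf_apply_of_forall_mem_zpowers hg, orderOf_dvd_iff_pow_eq_one, ← hχneg]
  have hsq : χ (-1) = 1 ∨ χ (-1) = -1 := by
    rw [← sq_eq_one_iff, ← map_pow, neg_one_sq, map_one]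
  rcases hsq with h | h <;> rw [h] <;> norm_num
end
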